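/- arXiv:2502.05294 — 9 statements merged into one kernel-verified Lean document; each statement's English description precedes it below -/
import Mathlib

section
/- Let L ⊆ V ⊕ εV be a K[ε]-submodule, F = π(L), G ⊆ V the subspace with εG = L ∩ εV, and M = (V ⊕ εV)/L the quotient K[ε]-module. Then L and M have the same torsion degree; more precisely both L^{(2)}/L^{(1)} and M^{(2)}/M^{(1)} are isomorphic as K-vector spaces to G/F, so dim_K(L^{(2)}/L^{(1)}) = dim_K(M^{(2)}/M^{(1)}) = dim_K G − dim_K F. -/
/-!
STATEMENT 2: Let `L ⊆ V ⊕ εV` be a `K[ε]`-submodule, `F = π(L)`, `G ⊆ V` the subspace with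
`εG = L ∩ εV`, and `M = (V ⊕ εV)/L` the quotient `K[ε]`-module.  Then `L` and `M` have the
same torsion degree; more precisely both `L⁽²⁾/L⁽¹⁾` and `M⁽²⁾/M⁽¹⁾` are isomorphic as
`K`-vector spaces to `G/F`, so
`dim_K (L⁽²⁾/L⁽¹⁾) = dim_K (M⁽²⁾/M⁽¹⁾) = dim_K G − dim_K F`.

We model `V ⊕ εV` as `V × V`, `(a, b) ↔ a + ε b`; multiplication by `ε` is
`eps : (a, b) ↦ (0, a)`, `π` is the first projection and `εV = ker π`.
-/

/-- Multiplication by `ε` on `V ⊕ εV ≅ V × V`: `(a, b) ↦ (0, a)`. -/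
noncomputable abbrev eps (K V : Type*) [Field K] [AddCommGroup V] [Module K V] :
    V × V →ₗ[K] V × V :=
  (LinearMap.inr K V V) ∘ₗ (LinearMap.fst K V V)

open Module

/-- A linear map `f : G → A` that is surjective modulo `P`, and for which `Q` is the preimage
of `P`, induces an isomorphism `A ⧸ P ≃ G ⧸ Q`. -/
theorem nonempty_quotient_equiv_of_surjective_mod {R A G : Type*} [Ring R] [AddCommGroup A]
    [Module R A] [AddCommGroup G] [Module R G] {P : Submodule R A} {Q : Submodule R G}
    (f : G →ₗ[R] A) (hsurj : ∀ a, ∃ g, f g - a ∈ P) (hmem : ∀ g, f g ∈ P ↔ g ∈ Q) :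
    Nonempty ((A ⧸ P) ≃ₗ[R] (G ⧸ Q)) := by
  have hker : Q = LinearMap.ker (P.mkQ ∘ₗ f) := by
    ext g
    simp [← hmem g]
  have hs : Function.Surjective (P.mkQ ∘ₗ f) := by
    intro y
    obtain ⟨a, rfl⟩ := P.mkQ_surjective y
    obtain ⟨g, hg⟩ := hsurj a
    exact ⟨g, (Submodule.Quotient.eq P).2 hg⟩
  exact ⟨((Submodule.quotEquivOfEq _ _ hker).trans
    ((P.mkQ ∘ₗ f).quotKerEquivOfSurjective hs)).symm⟩

/-- The dimension of `G ⧸ F` for nested subspaces `F ≤ G`. -/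
theorem finrank_quotient_comap_subtype {K V : Type*} [Field K] [AddCommGroup V] [Module K V]
    [FiniteDimensional K V] {F G : Submodule K V} (h : F ≤ G) :
    finrank K (↥G ⧸ F.comap G.subtype) = finrank K G - finrank K F := by
  rw [Submodule.finrank_quotient, (Submodule.comapSubtypeEquivOfLe h).finrank_eq]

theorem stmt2 {K V : Type*} [Field K] [AddCommGroup V] [Module K V] [FiniteDimensional K V]
    (L : Submodule K (V × V)) (hL : ∀ x ∈ L, eps K V x ∈ L)
    (F G : Submodule K V)
    (hF : F = L.map (LinearMap.fst K V V))
    (hG : G.map (LinearMap.inr K V V) = L ⊓ LinearMap.ker (LinearMap.fst K V V)) :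
    -- L⁽²⁾/L⁽¹⁾ ≅ G/F
    Nonempty
      ((↥(L ⊓ LinearMap.ker (eps K V)) ⧸
          (L.map (eps K V)).comap (L ⊓ LinearMap.ker (eps K V)).subtype)
        ≃ₗ[K] (↥G ⧸ F.comap G.subtype))
    -- M⁽²⁾/M⁽¹⁾ ≅ G/F
    ∧ Nonempty
      ((↥(LinearMap.ker (Submodule.mapQ L L (eps K V) (fun x hx => hL x hx))) ⧸
          (LinearMap.range (Submodule.mapQ L L (eps K V) (fun x hx => hL x hx))).comap
            (LinearMap.ker (Submodule.mapQ L L (eps K V) (fun x hx => hL x hx))).subtype)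
        ≃ₗ[K] (↥G ⧸ F.comap G.subtype))
    -- torsion degree of L equals dim G − dim F
    ∧ finrank K
        (↥(L ⊓ LinearMap.ker (eps K V)) ⧸
          (L.map (eps K V)).comap (L ⊓ LinearMap.ker (eps K V)).subtype)
        = finrank K G - finrank K F
    -- torsion degree of M equals dim G − dim F
    ∧ finrank K
        (↥(LinearMap.ker (Submodule.mapQ L L (eps K V) (fun x hx => hL x hx))) ⧸
          (LinearMap.range (Submodule.mapQ L L (eps K V) (fun x hx => hL x hx))).comap
            (LinearMap.ker (Submodule.mapQ L L (eps K V) (fun x hx => hL x hx))).subtype)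
        = finrank K G - finrank K F := by
  have hmemG : ∀ g, g ∈ G ↔ ((0 : V), g) ∈ L := by
    intro g
    have := congrArg (fun S => ((0 : V), g) ∈ S) hG
    simpa using this
  have hFG : F ≤ G := by
    intro a ha
    rw [hF] at ha
    obtain ⟨x, hx, rfl⟩ := ha
    exact (hmemG _).2 (hL x hx)
  have eL : Nonempty
      ((↥(L ⊓ LinearMap.ker (eps K V)) ⧸
          (L.map (eps K V)).comap (L ⊓ LinearMap.ker (eps K V)).subtype)
        ≃ₗ[K] (↥G ⧸ F.comap G.subtype)) := by
    refine nonempty_quotient_equiv_of_surjective_mod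
      (((LinearMap.inr K V V) ∘ₗ G.subtype).codRestrict _ fun g =>
        ⟨(hmemG _).1 g.2, by simp⟩) ?_ ?_
    · rintro ⟨⟨a, b⟩, hab, hker⟩
      obtain rfl : a = 0 := by simpa using hker
      refine ⟨⟨b, (hmemG b).2 hab⟩, ?_⟩
      convert Submodule.zero_mem _
      rw [sub_eq_zero]
      rfl
    · rintro ⟨g, hg⟩
      change ((0 : V), g) ∈ L.map (eps K V) ↔ g ∈ F
      simp [hF]
  have eM : Nonempty
      ((↥(LinearMap.ker (Submodule.mapQ L L (eps K V) (fun x hx => hL x hx))) ⧸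
          (LinearMap.range (Submodule.mapQ L L (eps K V) (fun x hx => hL x hx))).comap
            (LinearMap.ker (Submodule.mapQ L L (eps K V) (fun x hx => hL x hx))).subtype)
        ≃ₗ[K] (↥G ⧸ F.comap G.subtype)) := by
    refine nonempty_quotient_equiv_of_surjective_mod
      ((L.mkQ ∘ₗ (LinearMap.inl K V V) ∘ₗ G.subtype).codRestrict _ fun g =>
        (Submodule.Quotient.mk_eq_zero L).2 ((hmemG _).1 g.2)) ?_ ?_
    · rintro ⟨m, hm⟩
      obtain ⟨⟨a, b⟩, rfl⟩ := L.mkQ_surjective m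
      refine ⟨⟨a, (hmemG a).2 ((Submodule.Quotient.mk_eq_zero L).1 hm)⟩,
        L.mkQ (-b, 0), ?_⟩
      change L.mkQ (0, -b) = L.mkQ (a, 0) - L.mkQ (a, b)
      rw [← map_sub]
      simp
    · rintro ⟨g, hg⟩
      rw [Submodule.mem_comap, Submodule.mem_comap, hF]
      constructor
      · rintro ⟨m, hm⟩
        obtain ⟨⟨c, d⟩, rfl⟩ := L.mkQ_surjective m
        have h : ((0 : V), c) - (g, 0) ∈ L := (Submodule.Quotient.eq L).1 hm
        exact ⟨_, L.neg_mem h, by simp⟩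
      · rintro ⟨⟨a, b⟩, hx, rfl⟩
        refine ⟨L.mkQ (-b, 0), (Submodule.Quotient.eq L).2 ?_⟩
        convert L.neg_mem hx using 1
        simp
  exact ⟨eL, eM, eL.some.finrank_eq.trans (finrank_quotient_comap_subtype hFG),
    eM.some.finrank_eq.trans (finrank_quotient_comap_subtype hFG)⟩
end

section
/- Let L ⊆ V ⊕ εV be a K[ε]-submodule with dim_K L = n, set F = π(L) and let G ⊆ V be the subspace with εG = L ∩ εV. Then ε·F ⊆ L, hence F ⊆ G, and the dimension i = dim_K F satisfies max(0, n−r) ≤ i ≤ ⌊n/2⌋. -/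
open Module

theorem stmt3 {K V : Type*} [Field K] [AddCommGroup V] [Module K V] [FiniteDimensional K V]
    (L : Submodule K (V × V)) (hL : ∀ x ∈ L, eps K V x ∈ L)
    (n : ℕ) (hn : finrank K L = n)
    (F G : Submodule K V)
    (hF : F = L.map (LinearMap.fst K V V))
    (hG : G.map (LinearMap.inr K V V) = L ⊓ LinearMap.ker (LinearMap.fst K V V)) :
    F.map (LinearMap.inr K V V) ≤ L
    ∧ F ≤ G
    ∧ n - finrank K V ≤ finrank K F
    ∧ finrank K F ≤ n / 2 := by
  have h_map : F.map (LinearMap.inr K V V) ≤ L := by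
    rw [hF, ← Submodule.map_comp]
    exact Submodule.map_le_iff_le_comap.2 hL
  have h_inj : Function.Injective (LinearMap.inr K V V) := LinearMap.inr_injective
  have hFG : F ≤ G := by
    rw [← Submodule.map_le_map_iff_of_injective h_inj, hG]
    refine le_inf h_map ?_
    rintro _ ⟨y, -, rfl⟩
    simp
  have h_dim : finrank K F + finrank K G = n := by
    have h := ((LinearMap.fst K V V).domRestrict L).finrank_range_add_finrank_ker
    rw [LinearMap.range_domRestrict, LinearMap.ker_domRestrict, ← hF, hn] at h
    rw [← h, (Submodule.equivMapOfInjective _ h_inj G).finrank_eq, hG,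
      ← Submodule.map_comap_subtype,
      ← (Submodule.equivMapOfInjective _ L.subtype_injective _).finrank_eq]
  have hFG_dim := Submodule.finrank_mono hFG
  have hG_dim := G.finrank_le
  exact ⟨h_map, hFG, by lia, by lia⟩
end

section
/- Fix subspaces F ⊆ G ⊆ V with dim_K F = i and dim_K G = n − i. Then the assignment φ ↦ L_φ := { f + εv : f ∈ F, v ∈ V, v + G = φ(f) } is a bijection from the K-vector space Hom_K(F, V/G) onto the set of K[ε]-submodules L ⊆ V ⊕ εV with dim_K L = n, π(L) = F and L ∩ εV = εG. -/
open Module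

namespace Submodule

variable {K V : Type*} [Field K] [AddCommGroup V] [Module K V]

/-- The submodule `{(f, v) | f ∈ F, v + G = φ f}` of `V × V`. -/
def liftedGraph (F G : Submodule K V) (φ : F →ₗ[K] V ⧸ G) : Submodule K (V × V) where
  carrier := {x | ∃ h : x.1 ∈ F, Submodule.Quotient.mk x.2 = φ ⟨x.1, h⟩}
  zero_mem' := ⟨F.zero_mem, (map_zero φ).symm⟩
  add_mem' := by
    rintro x y ⟨hx, ex⟩ ⟨hy, ey⟩
    refine ⟨F.add_mem hx hy, ?_⟩
    rw [Prod.snd_add, Submodule.Quotient.mk_add, ex, ey, ← map_add]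
    rfl
  smul_mem' := by
    rintro c x ⟨hx, ex⟩
    refine ⟨F.smul_mem c hx, ?_⟩
    rw [Prod.smul_snd, Submodule.Quotient.mk_smul, ex, ← map_smul]
    rfl

theorem map_fst_liftedGraph (F G : Submodule K V) (φ : F →ₗ[K] V ⧸ G) :
    (liftedGraph F G φ).map (LinearMap.fst K V V) = F := by
  ext f
  constructor
  · rintro ⟨x, ⟨hx, -⟩, rfl⟩
    exact hx
  · intro hf
    obtain ⟨v, hv⟩ := Submodule.Quotient.mk_surjective G (φ ⟨f, hf⟩)
    exact ⟨(f, v), ⟨hf, hv⟩, rfl⟩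

theorem liftedGraph_inf_ker_fst (F G : Submodule K V) (φ : F →ₗ[K] V ⧸ G) :
    liftedGraph F G φ ⊓ LinearMap.ker (LinearMap.fst K V V) =
      G.map (LinearMap.inr K V V) := by
  have hφ (h : (0 : V) ∈ F) : φ ⟨0, h⟩ = 0 := map_zero φ
  ext ⟨a, b⟩
  constructor
  · rintro ⟨⟨ha, hb⟩, h0⟩
    obtain rfl : a = 0 := h0
    rw [hφ] at hb
    exact ⟨b, (Submodule.Quotient.mk_eq_zero G).1 hb, rfl⟩
  · rintro ⟨g, hg, h⟩
    obtain ⟨rfl, rfl⟩ := Prod.mk.inj h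
    exact ⟨⟨F.zero_mem, ((Submodule.Quotient.mk_eq_zero G).2 hg).trans (hφ F.zero_mem).symm⟩, rfl⟩

theorem eps_mem_liftedGraph {F G : Submodule K V} (hFG : F ≤ G) (φ : F →ₗ[K] V ⧸ G)
    {x : V × V} (hx : x ∈ liftedGraph F G φ) : eps K V x ∈ liftedGraph F G φ := by
  have : eps K V x ∈ G.map (LinearMap.inr K V V) := ⟨x.1, hFG hx.1, rfl⟩
  rw [← liftedGraph_inf_ker_fst F G φ] at this
  exact this.1

theorem finrank_map_add_finrank_inf_ker {W : Type*} [AddCommGroup W] [Module K W]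
    [FiniteDimensional K V] (L : Submodule K V) (f : V →ₗ[K] W) :
    finrank K (L.map f) + finrank K ↥(L ⊓ LinearMap.ker f) = finrank K L := by
  rw [← LinearMap.finrank_range_add_finrank_ker (f.domRestrict L), LinearMap.range_domRestrict,
    LinearMap.ker_domRestrict, ← Submodule.map_comap_subtype,
    Submodule.finrank_map_subtype_eq]

theorem finrank_liftedGraph [FiniteDimensional K V] (F G : Submodule K V)
    (φ : F →ₗ[K] V ⧸ G) : finrank K (liftedGraph F G φ) = finrank K F + finrank K G := by
  rw [← finrank_map_add_finrank_inf_ker _ (LinearMap.fst K V V), map_fst_liftedGraph,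
    liftedGraph_inf_ker_fst,
    ← (Submodule.equivMapOfInjective _ LinearMap.inr_injective G).finrank_eq]

theorem liftedGraph_injective (F G : Submodule K V) :
    Function.Injective (liftedGraph F G) := by
  intro φ ψ h
  ext ⟨f, hf⟩
  obtain ⟨v, hv⟩ := Submodule.Quotient.mk_surjective G (φ ⟨f, hf⟩)
  have hmem : (f, v) ∈ liftedGraph F G φ := ⟨hf, hv⟩
  rw [h] at hmem
  obtain ⟨_, hv'⟩ := hmem
  exact hv.symm.trans hv'

theorem exists_liftedGraph_eq {F G : Submodule K V} {L : Submodule K (V × V)}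
    (hF : L.map (LinearMap.fst K V V) = F)
    (hG : L ⊓ LinearMap.ker (LinearMap.fst K V V) = G.map (LinearMap.inr K V V)) :
    ∃ φ : F →ₗ[K] V ⧸ G, liftedGraph F G φ = L := by
  have hzero (v : V) : (0, v) ∈ L ↔ v ∈ G := by
    have : (0, v) ∈ L ⊓ LinearMap.ker (LinearMap.fst K V V) ↔
        (0, v) ∈ G.map (LinearMap.inr K V V) := by rw [hG]
    simpa using this
  have hex (f : F) : ∃ v : V, ((f : V), v) ∈ L := by
    obtain ⟨f, hf⟩ := f
    rw [← hF] at hf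
    obtain ⟨⟨a, v⟩, hx, rfl⟩ := hf
    exact ⟨v, hx⟩
  choose s hs using hex
  have hs' (f : F) (v : V) (hv : ((f : V), v) ∈ L) :
      (Submodule.Quotient.mk v : V ⧸ G) = Submodule.Quotient.mk (s f) := by
    rw [Submodule.Quotient.eq, ← hzero]
    simpa using L.sub_mem hv (hs f)
  let φ : F →ₗ[K] V ⧸ G :=
    { toFun f := Submodule.Quotient.mk (s f)
      map_add' f g := (hs' (f + g) (s f + s g) (L.add_mem (hs f) (hs g))).symm
      map_smul' c f := (hs' (c • f) (c • s f) (L.smul_mem c (hs f))).symm }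
  refine ⟨φ, ?_⟩
  ext ⟨f, v⟩
  constructor
  · rintro ⟨hf, hv⟩
    have hd : (0, v - s ⟨f, hf⟩) ∈ L := (hzero _).2 ((Submodule.Quotient.eq G).1 hv)
    simpa using L.add_mem hd (hs ⟨f, hf⟩)
  · intro h
    have hf : f ∈ F := hF ▸ ⟨(f, v), h, rfl⟩
    exact ⟨hf, hs' ⟨f, hf⟩ v h⟩

end Submodule

theorem stmt4 {K V : Type*} [Field K] [AddCommGroup V] [Module K V] [FiniteDimensional K V]
    (n i : ℕ) (F G : Submodule K V) (hFG : F ≤ G)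
    (hF : finrank K F = i) (hG : finrank K G = n - i) :
    Set.BijOn
      (fun φ : ↥F →ₗ[K] (V ⧸ G) =>
        {x : V × V | ∃ h : x.1 ∈ F, Submodule.Quotient.mk x.2 = φ ⟨x.1, h⟩})
      Set.univ
      {S : Set (V × V) | ∃ L : Submodule K (V × V),
        (L : Set (V × V)) = S
        ∧ (∀ x ∈ L, eps K V x ∈ L)
        ∧ finrank K L = n
        ∧ L.map (LinearMap.fst K V V) = F
        ∧ L ⊓ LinearMap.ker (LinearMap.fst K V V) = G.map (LinearMap.inr K V V)} := by
  have hn : finrank K F + finrank K G = n := by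
    have := Submodule.finrank_mono hFG
    omega
  refine ⟨fun φ _ => ⟨Submodule.liftedGraph F G φ, rfl,
    fun x hx => Submodule.eps_mem_liftedGraph hFG φ hx,
    (Submodule.finrank_liftedGraph F G φ).trans hn, Submodule.map_fst_liftedGraph F G φ,
    Submodule.liftedGraph_inf_ker_fst F G φ⟩, ?_, ?_⟩
  · intro φ _ ψ _ h
    exact Submodule.liftedGraph_injective F G (SetLike.coe_injective h)
  · rintro S ⟨L, rfl, -, -, hπ, hε⟩
    obtain ⟨φ, rfl⟩ := Submodule.exists_liftedGraph_eq hπ hε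
    exact ⟨φ, trivial, rfl⟩
end

section
/- Fix integers n and l with max(0, n−r) ≤ l ≤ ⌊n/2⌋. (a) For any subspace G ⊆ V with dim_K G = n − l, let q : G ⊕ εV → G ⊕ ε(V/G) be the map identity on G and reduction modulo G on the ε-part; then for every l-dimensional subspace F̃ ⊆ G ⊕ ε(V/G), the preimage L = q^{-1}(F̃) ⊆ G ⊕ εV ⊆ V ⊕ εV is a K[ε]-submodule of V ⊕ εV with dim_K L = n and dim_K(L ∩ εV) ≥ n − l. (b) Conversely, every K[ε]-submodule L ⊆ V ⊕ εV with dim_K L = n and dim_K(L ∩ εV) ≥ n − l arises as q^{-1}(F̃) for some such G and F̃. (c) If F ⊆ G has dim_K F = l and φ ∈ Hom_K(F, V/G), and F̃ is the image of the map F → G ⊕ ε(V/G), f ↦ f + εφ(f), then q^{-1}(F̃) = { f + εv : f ∈ F, v ∈ V, v + G = φ(f) }. -/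
open Module

/-- Rank-nullity for the restriction of `f` to a subspace. -/
theorem finrank_map_add_finrank_inf_ker {K M N : Type*} [Field K] [AddCommGroup M] [Module K M]
    [FiniteDimensional K M] [AddCommGroup N] [Module K N] (f : M →ₗ[K] N) (L : Submodule K M) :
    finrank K (L.map f) + finrank K ↥(L ⊓ LinearMap.ker f) = finrank K L := by
  have h := LinearMap.finrank_range_add_finrank_ker (f.domRestrict L)
  rw [LinearMap.range_domRestrict, LinearMap.ker_domRestrict] at h
  rw [← h, ← Submodule.finrank_map_subtype_eq, Submodule.map_comap_subtype]

/-- Between nested subspaces there are subspaces of every intermediate dimension. -/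
theorem exists_between_finrank_eq {K M : Type*} [Field K] [AddCommGroup M] [Module K M]
    [FiniteDimensional K M] {A B : Submodule K M} (hAB : A ≤ B) {m : ℕ}
    (hAm : finrank K A ≤ m) (hmB : m ≤ finrank K B) :
    ∃ G : Submodule K M, A ≤ G ∧ G ≤ B ∧ finrank K G = m := by
  induction m, hAm using Nat.le_induction with
  | base => exact ⟨A, le_rfl, hAB, rfl⟩
  | succ m _ ih =>
    obtain ⟨G, hAG, hGB, hG⟩ := ih (by omega)
    obtain ⟨v, hvB, hvG⟩ := SetLike.exists_of_lt
      (lt_of_le_of_ne hGB (by rintro rfl; omega))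
    exact ⟨G ⊔ K ∙ v, hAG.trans le_sup_left,
      sup_le hGB ((Submodule.span_singleton_le_iff_mem _ _).2 hvB),
      by rw [Submodule.finrank_sup_span_singleton hvG, hG]⟩

/-- The kernel of reduction of the second component modulo `G` is `0 × G`. -/
theorem ker_prodMap_id_mkQ {K V : Type*} [Field K] [AddCommGroup V] [Module K V]
    (G : Submodule K V) :
    LinearMap.ker (LinearMap.prodMap (LinearMap.id : V →ₗ[K] V) G.mkQ) =
      G.map (LinearMap.inr K V V) := by
  ext ⟨a, b⟩
  simp only [LinearMap.mem_ker, LinearMap.prodMap_apply, LinearMap.id_apply, Prod.mk_eq_zero,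
    Submodule.mkQ_apply, Submodule.Quotient.mk_eq_zero, Submodule.mem_map, LinearMap.inr_apply,
    Prod.mk.injEq]
  constructor
  · rintro ⟨rfl, hb⟩
    exact ⟨b, hb, rfl, rfl⟩
  · rintro ⟨c, hc, rfl, rfl⟩
    exact ⟨rfl, hc⟩

theorem finrank_map_inr {K V : Type*} [Field K] [AddCommGroup V] [Module K V]
    (G : Submodule K V) : finrank K (G.map (LinearMap.inr K V V)) = finrank K G :=
  (Submodule.equivMapOfInjective _ LinearMap.inr_injective G).finrank_eq.symm

theorem stmt6 {K V : Type*} [Field K] [AddCommGroup V] [Module K V] [FiniteDimensional K V]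
    (n l : ℕ) (hl1 : n - finrank K V ≤ l) (hl2 : l ≤ n / 2) :
    -- (a)
    (∀ G : Submodule K V, finrank K G = n - l →
      ∀ Ft : Submodule K (V × (V ⧸ G)), finrank K Ft = l →
        Ft ≤ Submodule.comap (LinearMap.fst K V (V ⧸ G)) G →
        (∀ x ∈ Submodule.comap (LinearMap.prodMap LinearMap.id G.mkQ) Ft,
            eps K V x ∈ Submodule.comap (LinearMap.prodMap LinearMap.id G.mkQ) Ft)
        ∧ finrank K (Submodule.comap (LinearMap.prodMap LinearMap.id G.mkQ) Ft) = n
        ∧ n - l ≤ finrank K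
            ↥(Submodule.comap (LinearMap.prodMap LinearMap.id G.mkQ) Ft
              ⊓ LinearMap.ker (LinearMap.fst K V V)))
    -- (b)
    ∧ (∀ L : Submodule K (V × V), (∀ x ∈ L, eps K V x ∈ L) → finrank K L = n →
        n - l ≤ finrank K ↥(L ⊓ LinearMap.ker (LinearMap.fst K V V)) →
        ∃ G : Submodule K V, ∃ Ft : Submodule K (V × (V ⧸ G)),
          finrank K G = n - l ∧ finrank K Ft = l
          ∧ Ft ≤ Submodule.comap (LinearMap.fst K V (V ⧸ G)) G
          ∧ L = Submodule.comap (LinearMap.prodMap LinearMap.id G.mkQ) Ft)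
    -- (c)
    ∧ (∀ G F : Submodule K V, F ≤ G → finrank K F = l →
        ∀ φ : ↥F →ₗ[K] (V ⧸ G),
          ((Submodule.comap (LinearMap.prodMap LinearMap.id G.mkQ)
              (LinearMap.range (F.subtype.prod φ)) : Submodule K (V × V)) : Set (V × V))
            = {x : V × V | ∃ h : x.1 ∈ F, Submodule.Quotient.mk x.2 = φ ⟨x.1, h⟩}) := by
  refine ⟨fun G hG Ft hFt hle => ?_, fun L hL hLn hLk => ?_, fun G F _ _ φ => ?_⟩
  · have hker : G.map (LinearMap.inr K V V) ≤
        Submodule.comap (LinearMap.prodMap LinearMap.id G.mkQ) Ft :=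
      ker_prodMap_id_mkQ G ▸ LinearMap.ker_le_comap _
    refine ⟨fun x hx => hker ⟨x.1, hle hx, rfl⟩, ?_, ?_⟩
    · have h := finrank_map_add_finrank_inf_ker (LinearMap.prodMap LinearMap.id G.mkQ)
        (Submodule.comap (LinearMap.prodMap LinearMap.id G.mkQ) Ft)
      rw [Submodule.map_comap_eq_of_surjective
          (Function.surjective_id.prodMap G.mkQ_surjective),
        ker_prodMap_id_mkQ, inf_eq_right.2 hker, finrank_map_inr] at h
      omega
    · rw [← hG, ← finrank_map_inr]
      refine Submodule.finrank_mono (le_inf hker ?_)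
      rintro _ ⟨g, _, rfl⟩
      simp
  · have hfst := finrank_map_add_finrank_inf_ker (LinearMap.fst K V V) L
    have hB : (L.comap (LinearMap.inr K V V)).map (LinearMap.inr K V V) =
        L ⊓ LinearMap.ker (LinearMap.fst K V V) := by
      rw [Submodule.map_comap_eq, LinearMap.range_inr, inf_comm]
    have hAB : L.map (LinearMap.fst K V V) ≤ L.comap (LinearMap.inr K V V) := by
      rintro _ ⟨x, hx, rfl⟩
      exact hL x hx
    rw [← hB, finrank_map_inr] at hfst hLk
    obtain ⟨G, hAG, hGB, hG⟩ := exists_between_finrank_eq hAB (m := n - l) (by omega) hLk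
    have hker : LinearMap.ker (LinearMap.prodMap LinearMap.id G.mkQ) ≤ L := by
      rw [ker_prodMap_id_mkQ]
      exact Submodule.map_le_iff_le_comap.2 hGB
    refine ⟨G, L.map (LinearMap.prodMap LinearMap.id G.mkQ), hG, ?_, ?_, ?_⟩
    · have h := finrank_map_add_finrank_inf_ker (LinearMap.prodMap LinearMap.id G.mkQ) L
      rw [inf_eq_right.2 hker, ker_prodMap_id_mkQ, finrank_map_inr] at h
      omega
    · rintro _ ⟨x, hx, rfl⟩
      exact hAG ⟨x, hx, rfl⟩
    · exact (Submodule.comap_map_eq_self hker).symm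
  · ext ⟨a, b⟩
    constructor
    · rintro ⟨f, hf⟩
      obtain ⟨rfl, h⟩ := Prod.ext_iff.1 hf
      exact ⟨f.2, h.symm⟩
    · rintro ⟨h, hb⟩
      exact ⟨⟨a, h⟩, Prod.ext rfl hb.symm⟩
end

section
/- Let L ⊆ V ⊕ εV be a K[ε]-submodule, F = π(L), G ⊆ V the subspace with εG = L ∩ εV, and M = (V ⊕ εV)/L. Let φ : L → M be a K-linear map satisfying φ(εG) ⊆ (εV + L)/L. Define t_G : G → V/G by t_G(g) = v + G where v ∈ V is any vector with φ(εg) = εv + L (this is well defined), and define t_F : F → V/F by t_F(f) = π̄(φ(l)) for any l ∈ L with π(l) = f, where π̄ : M → V/F is induced by π (this is well defined). Then φ is K[ε]-linear if and only if for every f ∈ F the classes t_F(f) ∈ V/F and t_G(f) ∈ V/G agree under the canonical projection V/F → V/G, i.e. π_{(F,G)} ∘ t_F = t_G ∘ i_{(F,G)} where i_{(F,G)} : F ↪ G is the inclusion. -/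
theorem stmt7 {K V : Type*} [Field K] [AddCommGroup V] [Module K V]
    (L : Submodule K (V × V)) (hL : ∀ x ∈ L, eps K V x ∈ L)
    (F G : Submodule K V)
    (hF : F = L.map (LinearMap.fst K V V))
    (hG : G.map (LinearMap.inr K V V) = L ⊓ LinearMap.ker (LinearMap.fst K V V))
    (hFG : F ≤ Submodule.comap LinearMap.id G)
    (hπ : L ≤ Submodule.comap (LinearMap.fst K V V) F)
    (φ : ↥L →ₗ[K] (V × V) ⧸ L)
    (hφ : ∀ x : ↥L, (x : V × V).1 = 0 →
      φ x ∈ Submodule.map L.mkQ (LinearMap.ker (LinearMap.fst K V V))) :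
    -- φ is K[ε]-linear …
    (∀ x : ↥L, φ ((eps K V).restrict hL x)
        = Submodule.mapQ L L (eps K V) (fun y hy => hL y hy) (φ x))
    -- … iff π_{(F,G)} ∘ t_F = t_G ∘ i_{(F,G)}
    ↔ (∀ (x : ↥L) (v : V), φ ((eps K V).restrict hL x) = L.mkQ ((0 : V), v) →
        Submodule.mapQ F G LinearMap.id hFG
            (Submodule.mapQ L F (LinearMap.fst K V V) hπ (φ x))
          = G.mkQ v) := by
  have mem_G (v : V) : v ∈ G ↔ ((0 : V), v) ∈ L := by
    have h := SetLike.ext_iff.mp hG ((0 : V), v)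
    simpa using h
  have mkQ_eq_iff (v w : V) : L.mkQ ((0 : V), v) = L.mkQ ((0 : V), w) ↔ G.mkQ v = G.mkQ w := by
    simp only [Submodule.mkQ_apply, Submodule.Quotient.eq, mem_G, Prod.mk_sub_mk, sub_zero]
  constructor
  · intro h x v hv
    obtain ⟨⟨a, b⟩, hab⟩ := L.mkQ_surjective (φ x)
    have hx := h x
    rw [hv, ← hab] at hx
    rw [← hab]
    exact ((mkQ_eq_iff v a).mp hx).symm
  · intro h x
    obtain ⟨⟨a, b⟩, hab⟩ := L.mkQ_surjective (φ x)
    obtain ⟨⟨c, v⟩, hc, hv⟩ := hφ ((eps K V).restrict hL x) rfl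
    obtain rfl : c = 0 := hc
    have hx := h x v hv.symm
    rw [← hab] at hx
    rw [← hab, ← hv]
    exact (mkQ_eq_iff v a).mpr hx.symm
end

section
/- If L ⊆ V ⊕ εV is a Lagrangian K[ε]-submodule, then the map (V ⊕ εV)/L → Hom_{K[ε]}(L, K[ε]) induced by v ↦ b₂(v, −)|_L is a well-defined K[ε]-linear isomorphism. -/
/-- Multiplication by `ε` on `K[ε] ≅ K × K`: `(a, b) ↦ (0, a)`. -/
noncomputable abbrev epsK (K : Type*) [Field K] : K × K →ₗ[K] K × K :=
  (LinearMap.inr K K K) ∘ₗ (LinearMap.fst K K K)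

/-- The `K[ε]`-bilinear extension `b₂` of a bilinear form `b₁` on `V` to `V ⊕ εV`,
with values in `K[ε] = K × K`. -/
noncomputable def b2 {K V : Type*} [Field K] [AddCommGroup V] [Module K V]
    (b₁ : V →ₗ[K] V →ₗ[K] K) : (V × V) →ₗ[K] (V × V) →ₗ[K] K × K :=
  LinearMap.mk₂ K (fun x y => (b₁ x.1 y.1, b₁ x.1 y.2 + b₁ x.2 y.1))
    (fun m m' n => by simp [Prod.ext_iff]; ring)
    (fun c m n => by simp [Prod.ext_iff]; ring)
    (fun m n n' => by simp [Prod.ext_iff]; ring)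
    (fun c m n => by simp [Prod.ext_iff]; ring)

@[simp]
theorem b2_apply {K V : Type*} [Field K] [AddCommGroup V] [Module K V]
    (b₁ : V →ₗ[K] V →ₗ[K] K) (x y : V × V) :
    b2 b₁ x y = (b₁ x.1 y.1, b₁ x.1 y.2 + b₁ x.2 y.1) :=
  rfl

/-- The `ε`-coefficient of `b2 b₁`, a `K`-valued bilinear form on `V × V`. -/
noncomputable def b2Snd {K V : Type*} [Field K] [AddCommGroup V] [Module K V]
    (b₁ : V →ₗ[K] V →ₗ[K] K) : LinearMap.BilinForm K (V × V) :=
  (b2 b₁).compr₂ (LinearMap.snd K K K)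

@[simp]
theorem b2Snd_apply {K V : Type*} [Field K] [AddCommGroup V] [Module K V]
    (b₁ : V →ₗ[K] V →ₗ[K] K) (x y : V × V) :
    b2Snd b₁ x y = b₁ x.1 y.2 + b₁ x.2 y.1 :=
  rfl

theorem b2Snd_isRefl {K V : Type*} [Field K] [AddCommGroup V] [Module K V]
    {b₁ : V →ₗ[K] V →ₗ[K] K} (hsymm : ∀ v w : V, b₁ v w = b₁ w v) :
    (b2Snd b₁).IsRefl := by
  intro x y h
  rw [b2Snd_apply] at h ⊢
  rw [hsymm y.1, hsymm y.2, add_comm, h]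

theorem b2Snd_nondegenerate {K V : Type*} [Field K] [AddCommGroup V] [Module K V]
    {b₁ : V →ₗ[K] V →ₗ[K] K} (hsymm : ∀ v w : V, b₁ v w = b₁ w v)
    (hnd : ∀ v : V, (∀ w : V, b₁ v w = 0) → v = 0) :
    (b2Snd b₁).Nondegenerate := by
  refine (LinearMap.IsRefl.nondegenerate_iff_separatingLeft (b2Snd_isRefl hsymm)).2 fun x hx => ?_
  refine Prod.ext (hnd _ fun w => ?_) (hnd _ fun w => ?_)
  · simpa using hx (0, w)
  · simpa using hx (w, 0)

/-- An isotropic subspace of half the dimension is its own orthogonal complement. -/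
theorem orthogonal_eq_self_of_finrank {K W : Type*} [Field K] [AddCommGroup W] [Module K W]
    [FiniteDimensional K W] {B : LinearMap.BilinForm K W} (hB : B.Nondegenerate)
    {L : Submodule K W} (hL : L ≤ B.orthogonal L)
    (hdim : Module.finrank K W = Module.finrank K L + Module.finrank K L) :
    B.orthogonal L = L := by
  refine (Submodule.eq_of_le_of_finrank_eq hL ?_).symm
  rw [LinearMap.BilinForm.finrank_orthogonal hB, hdim, Nat.add_sub_cancel]

/-- A nondegenerate form represents every functional on a subspace. -/
theorem exists_forall_apply_eq_of_nondegenerate {K W : Type*} [Field K] [AddCommGroup W]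
    [Module K W] [FiniteDimensional K W] {B : LinearMap.BilinForm K W} (hB : B.Nondegenerate)
    {L : Submodule K W} (f : L →ₗ[K] K) : ∃ v : W, ∀ x : L, B v x = f x := by
  obtain ⟨g, hg⟩ := f.exists_extend
  refine ⟨(B.toDual hB).symm g, fun x => ?_⟩
  rw [LinearMap.BilinForm.apply_toDual_symm_apply, ← hg]
  rfl

theorem stmt8 {K V : Type*} [Field K] [AddCommGroup V] [Module K V] [FiniteDimensional K V]
    (hchar : (2 : K) ≠ 0)
    (b₁ : V →ₗ[K] V →ₗ[K] K)
    (hsymm : ∀ v w : V, b₁ v w = b₁ w v)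
    (hnd : ∀ v : V, (∀ w : V, b₁ v w = 0) → v = 0)
    (L : Submodule K (V × V)) (hL : ∀ x ∈ L, eps K V x ∈ L)
    (hiso : ∀ x ∈ L, ∀ y ∈ L, b2 b₁ x y = 0)
    (hdim : Module.finrank K L = Module.finrank K V) :
    -- (i) b₂(v,−)|_L is K[ε]-linear
    (∀ (v : V × V) (x : ↥L), b2 b₁ v (eps K V x) = epsK K (b2 b₁ v x))
    -- (ii) kernel of v ↦ b₂(v,−)|_L is exactly L
    ∧ (∀ v : V × V, (∀ x ∈ L, b2 b₁ v x = 0) ↔ v ∈ L)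
    -- (iii) surjectivity onto Hom_{K[ε]}(L, K[ε])
    ∧ (∀ ψ : ↥L →ₗ[K] K × K,
        (∀ x : ↥L, ψ ((eps K V).restrict hL x) = epsK K (ψ x)) →
        ∃ v : V × V, ∀ x : ↥L, b2 b₁ v x = ψ x)
    -- (iv) K[ε]-linearity of the induced map
    ∧ (∀ (v : V × V) (x : ↥L), b2 b₁ (eps K V v) x = epsK K (b2 b₁ v x)) := by
  have hB := b2Snd_nondegenerate hsymm hnd
  have horth : (b2Snd b₁).orthogonal L = L :=
    orthogonal_eq_self_of_finrank hB
      (fun x hx y hy => congrArg Prod.snd (hiso y hy x hx))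
      (by rw [Module.finrank_prod, hdim])
  refine ⟨fun v x => by simp, fun v => ⟨fun h => ?_, fun hv x hx => hiso v hv x hx⟩,
    fun ψ hψ => ?_, fun v x => by simp⟩
  · rw [← horth]
    exact fun y hy => b2Snd_isRefl hsymm _ _ (congrArg Prod.snd (h y hy))
  · obtain ⟨v, hv⟩ :=
      exists_forall_apply_eq_of_nondegenerate hB ((LinearMap.snd K K K) ∘ₗ ψ)
    refine ⟨v, fun x => Prod.ext ?_ (hv x)⟩
    have h := hv ((eps K V).restrict hL x)
    rw [LinearMap.comp_apply, hψ] at h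
    simpa using h
end

section
/- Fix an isotropic subspace F ⊆ V. Call a linear map φ : F → V/F^⊥ skew-symmetric if the bilinear form (f, f') ↦ b₁(v, f') on F × F, where v ∈ V is any lift of φ(f), is well defined and skew-symmetric. Then the assignment φ ↦ L_φ := { f + εv : f ∈ F, v ∈ V, v + F^⊥ = φ(f) } is a bijection from the space of skew-symmetric linear maps φ : F → V/F^⊥ onto the set of Lagrangian K[ε]-submodules L ⊆ V ⊕ εV with π(L) = F. -/
/-- The orthogonal complement `F^⊥ = {v ∈ V : b₁(v, f) = 0 ∀ f ∈ F}`. -/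
def perp {K V : Type*} [Field K] [AddCommGroup V] [Module K V]
    (b₁ : V →ₗ[K] V →ₗ[K] K) (F : Submodule K V) : Submodule K V where
  carrier := {v | ∀ f ∈ F, b₁ v f = 0}
  add_mem' := by
    intro a b ha hb f hf
    simp [ha f hf, hb f hf]
  zero_mem' := by
    intro f hf
    simp
  smul_mem' := by
    intro c a ha f hf
    simp [ha f hf]

/-- Skew-symmetric linear maps `φ : F → V/F^⊥`. -/
def Skew {K V : Type*} [Field K] [AddCommGroup V] [Module K V]
    (b₁ : V →ₗ[K] V →ₗ[K] K) (F : Submodule K V) :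
    Set (↥F →ₗ[K] V ⧸ perp b₁ F) :=
  {φ | ∀ (f f' : ↥F) (v v' : V),
    Submodule.Quotient.mk v = φ f → Submodule.Quotient.mk v' = φ f' →
    b₁ v f' = - b₁ v' f}

section Helpers

open Module

variable {K V : Type*} [Field K] [AddCommGroup V] [Module K V]

theorem mem_perp {b₁ : V →ₗ[K] V →ₗ[K] K} {F : Submodule K V} {v : V} :
    v ∈ perp b₁ F ↔ ∀ f ∈ F, b₁ v f = 0 :=
  Iff.rfl

theorem b2_eq_zero_iff {b₁ : V →ₗ[K] V →ₗ[K] K} {x y : V × V} :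
    b2 b₁ x y = 0 ↔ b₁ x.1 y.1 = 0 ∧ b₁ x.1 y.2 + b₁ x.2 y.1 = 0 := by
  simp [b2, Prod.ext_iff]

theorem finrank_perp_add_finrank [FiniteDimensional K V] {b₁ : V →ₗ[K] V →ₗ[K] K}
    (hsymm : ∀ v w : V, b₁ v w = b₁ w v) (hnd : ∀ v : V, (∀ w : V, b₁ v w = 0) → v = 0)
    (F : Submodule K V) : finrank K (perp b₁ F) + finrank K F = finrank K V := by
  have hB : LinearMap.BilinForm.Nondegenerate b₁ :=
    ⟨hnd, fun v hv => hnd v fun w => (hsymm v w).trans (hv w)⟩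
  have hperp : perp b₁ F = LinearMap.BilinForm.orthogonal b₁ F := by
    ext v
    rw [mem_perp, LinearMap.BilinForm.mem_orthogonal_iff]
    exact forall₂_congr fun f _ => by rw [hsymm]
  rw [hperp, LinearMap.BilinForm.finrank_orthogonal hB]
  exact Nat.sub_add_cancel F.finrank_le

/-- Rank-nullity for the first projection restricted to a subspace of `V × V`. -/
theorem finrank_comap_inr_add_finrank_map_fst [FiniteDimensional K V]
    (L : Submodule K (V × V)) :
    finrank K (L.comap (LinearMap.inr K V V)) + finrank K (L.map (LinearMap.fst K V V)) =
      finrank K L := by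
  have hker : (L.comap (LinearMap.inr K V V)).map (LinearMap.inr K V V) =
      (LinearMap.ker ((LinearMap.fst K V V).domRestrict L)).map L.subtype := by
    ext ⟨a, b⟩
    simp only [Submodule.mem_map, Submodule.mem_comap, LinearMap.mem_ker]
    constructor
    · rintro ⟨v, hv, h⟩
      exact ⟨⟨_, hv⟩, rfl, h⟩
    · rintro ⟨⟨⟨c, d⟩, hx⟩, rfl, h⟩
      exact ⟨d, hx, h⟩
  have h := LinearMap.finrank_range_add_finrank_ker ((LinearMap.fst K V V).domRestrict L)
  rw [LinearMap.range_domRestrict] at h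
  have hrank := (LinearEquiv.ofEq _ _ hker).finrank_eq
  rw [← (Submodule.equivMapOfInjective _ LinearMap.inr_injective _).finrank_eq,
    ← (Submodule.equivMapOfInjective _ L.subtype_injective _).finrank_eq] at hrank
  omega

/-- The subspace `L_φ = {f + εv : f ∈ F, v + F^⊥ = φ f}` of `V ⊕ εV`. -/
def graphLift {b₁ : V →ₗ[K] V →ₗ[K] K} {F : Submodule K V} (φ : F →ₗ[K] V ⧸ perp b₁ F) :
    Submodule K (V × V) where
  carrier := {x | ∃ h : x.1 ∈ F, Submodule.Quotient.mk x.2 = φ ⟨x.1, h⟩}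
  add_mem' := by
    rintro x y ⟨hx, hx'⟩ ⟨hy, hy'⟩
    refine ⟨F.add_mem hx hy, ?_⟩
    rw [Prod.snd_add, Submodule.Quotient.mk_add, hx', hy', ← map_add]
    rfl
  zero_mem' := ⟨F.zero_mem, (map_zero φ).symm⟩
  smul_mem' := by
    rintro c x ⟨hx, hx'⟩
    refine ⟨F.smul_mem c hx, ?_⟩
    rw [Prod.smul_snd, Submodule.Quotient.mk_smul, hx', ← map_smul]
    rfl

section graphLift

variable {b₁ : V →ₗ[K] V →ₗ[K] K} {F : Submodule K V} (φ : F →ₗ[K] V ⧸ perp b₁ F)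

theorem mem_graphLift {x : V × V} :
    x ∈ graphLift φ ↔ ∃ h : x.1 ∈ F, Submodule.Quotient.mk x.2 = φ ⟨x.1, h⟩ :=
  Iff.rfl

theorem map_fst_graphLift : (graphLift φ).map (LinearMap.fst K V V) = F := by
  ext f
  constructor
  · rintro ⟨x, ⟨hx, -⟩, rfl⟩
    exact hx
  · intro hf
    obtain ⟨v, hv⟩ := Submodule.Quotient.mk_surjective _ (φ ⟨f, hf⟩)
    exact ⟨(f, v), ⟨hf, hv⟩, rfl⟩

theorem comap_inr_graphLift : (graphLift φ).comap (LinearMap.inr K V V) = perp b₁ F := by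
  ext v
  have h0 : φ ⟨0, F.zero_mem⟩ = 0 := map_zero φ
  simp [mem_graphLift, h0]

theorem graphLift_injective :
    Function.Injective (graphLift : (F →ₗ[K] V ⧸ perp b₁ F) → Submodule K (V × V)) := by
  intro φ ψ h
  ext f
  obtain ⟨v, hv⟩ := Submodule.Quotient.mk_surjective _ (φ f)
  have hmem : ((f : V), v) ∈ graphLift φ := ⟨f.2, hv⟩
  rw [h] at hmem
  exact hv.symm.trans hmem.2

theorem mem_skew_iff (hsymm : ∀ v w : V, b₁ v w = b₁ w v)
    (hisoF : ∀ f ∈ F, ∀ f' ∈ F, b₁ f f' = 0) :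
    φ ∈ Skew b₁ F ↔ ∀ x ∈ graphLift φ, ∀ y ∈ graphLift φ, b2 b₁ x y = 0 := by
  constructor
  · rintro hφ x ⟨hx, hx'⟩ y ⟨hy, hy'⟩
    refine b2_eq_zero_iff.2 ⟨hisoF _ hx _ hy, ?_⟩
    have h := hφ ⟨x.1, hx⟩ ⟨y.1, hy⟩ x.2 y.2 hx' hy'
    rw [hsymm x.1, h, add_neg_cancel]
  · intro h f f' v v' hv hv'
    have h' := (b2_eq_zero_iff.1 (h (f, v) ⟨f.2, hv⟩ (f', v') ⟨f'.2, hv'⟩)).2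
    rw [hsymm v']
    exact eq_neg_of_add_eq_zero_right h'

theorem eps_mem_graphLift (hisoF : ∀ f ∈ F, ∀ f' ∈ F, b₁ f f' = 0) {x : V × V}
    (hx : x ∈ graphLift φ) : eps K V x ∈ graphLift φ := by
  have h : x.1 ∈ (graphLift φ).comap (LinearMap.inr K V V) := by
    rw [comap_inr_graphLift]
    exact hisoF _ hx.1
  exact h

theorem finrank_graphLift [FiniteDimensional K V] (hsymm : ∀ v w : V, b₁ v w = b₁ w v)
    (hnd : ∀ v : V, (∀ w : V, b₁ v w = 0) → v = 0) :
    finrank K (graphLift φ) = finrank K V := by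
  rw [← finrank_comap_inr_add_finrank_map_fst, map_fst_graphLift, comap_inr_graphLift,
    finrank_perp_add_finrank hsymm hnd]

end graphLift

/-- A subspace `L` of `V ⊕ εV` projecting onto `F` whose intersection with `εV` is `εF^⊥`
is of the form `L_φ`. -/
theorem exists_graphLift_eq {b₁ : V →ₗ[K] V →ₗ[K] K} {F : Submodule K V}
    {L : Submodule K (V × V)} (hmap : L.map (LinearMap.fst K V V) = F)
    (hcomap : L.comap (LinearMap.inr K V V) = perp b₁ F) :
    ∃ φ : F →ₗ[K] V ⧸ perp b₁ F, graphLift φ = L := by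
  have hmem : ∀ x : L, (x : V × V).1 ∈ F := fun x => hmap ▸ ⟨x, x.2, rfl⟩
  let p : L →ₗ[K] F := (LinearMap.fst K V V ∘ₗ L.subtype).codRestrict F hmem
  have hp : LinearMap.range p = ⊤ := by
    rw [LinearMap.range_eq_top]
    rintro ⟨f, hf⟩
    obtain ⟨x, hx, rfl⟩ : f ∈ L.map (LinearMap.fst K V V) := hmap ▸ hf
    exact ⟨⟨x, hx⟩, rfl⟩
  obtain ⟨s, hs⟩ := p.exists_rightInverse_of_surjective hp
  have hs' : ∀ f : F, (s f : V × V).1 = f := fun f =>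
    congrArg Subtype.val (LinearMap.congr_fun hs f)
  refine ⟨(perp b₁ F).mkQ ∘ₗ LinearMap.snd K V V ∘ₗ L.subtype ∘ₗ s, ?_⟩
  have key : ∀ (x : V × V) (hx : x.1 ∈ F),
      x.2 - (s ⟨x.1, hx⟩ : V × V).2 ∈ perp b₁ F ↔ x ∈ L := by
    intro x hx
    rw [← hcomap, Submodule.mem_comap]
    have hsub : LinearMap.inr K V V (x.2 - (s ⟨x.1, hx⟩ : V × V).2) =
        x - (s ⟨x.1, hx⟩ : V × V) :=
      Prod.ext (by simp [hs']) rfl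
    rw [hsub]
    exact L.sub_mem_iff_left (s ⟨x.1, hx⟩).2
  ext x
  rw [mem_graphLift]
  constructor
  · rintro ⟨hx, h⟩
    exact (key x hx).1 ((Submodule.Quotient.eq _).1 h)
  · intro hxL
    exact ⟨hmem ⟨x, hxL⟩, (Submodule.Quotient.eq _).2 ((key x _).2 hxL)⟩

/-- An isotropic `L` of dimension `dim V` with `π(L) = F` meets `εV` in `εF^⊥`. -/
theorem comap_inr_eq_perp [FiniteDimensional K V] {b₁ : V →ₗ[K] V →ₗ[K] K}
    (hsymm : ∀ v w : V, b₁ v w = b₁ w v) (hnd : ∀ v : V, (∀ w : V, b₁ v w = 0) → v = 0)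
    {F : Submodule K V} {L : Submodule K (V × V)}
    (hiso : ∀ x ∈ L, ∀ y ∈ L, b2 b₁ x y = 0) (hrank : finrank K L = finrank K V)
    (hmap : L.map (LinearMap.fst K V V) = F) :
    L.comap (LinearMap.inr K V V) = perp b₁ F := by
  apply Submodule.eq_of_le_of_finrank_eq
  · intro v hv f hf
    obtain ⟨y, hy, rfl⟩ : f ∈ L.map (LinearMap.fst K V V) := hmap ▸ hf
    simpa using (b2_eq_zero_iff.1 (hiso _ hv y hy)).2
  · have h₁ := finrank_comap_inr_add_finrank_map_fst L
    have h₂ := finrank_perp_add_finrank hsymm hnd F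
    rw [hmap] at h₁
    omega

end Helpers

theorem stmt10 {K V : Type*} [Field K] [AddCommGroup V] [Module K V] [FiniteDimensional K V]
    (hchar : (2 : K) ≠ 0)
    (b₁ : V →ₗ[K] V →ₗ[K] K)
    (hsymm : ∀ v w : V, b₁ v w = b₁ w v)
    (hnd : ∀ v : V, (∀ w : V, b₁ v w = 0) → v = 0)
    (F : Submodule K V) (hisoF : ∀ f ∈ F, ∀ f' ∈ F, b₁ f f' = 0) :
    Set.BijOn
      (fun φ : ↥F →ₗ[K] V ⧸ perp b₁ F =>
        {x : V × V | ∃ h : x.1 ∈ F, Submodule.Quotient.mk x.2 = φ ⟨x.1, h⟩})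
      (Skew b₁ F)
      {S : Set (V × V) | ∃ L : Submodule K (V × V),
        (L : Set (V × V)) = S
        ∧ (∀ x ∈ L, eps K V x ∈ L)
        ∧ (∀ x ∈ L, ∀ y ∈ L, b2 b₁ x y = 0)
        ∧ Module.finrank K L = Module.finrank K V
        ∧ L.map (LinearMap.fst K V V) = F} := by
  refine ⟨fun φ hφ => ⟨graphLift φ, rfl, fun x hx => eps_mem_graphLift φ hisoF hx,
    (mem_skew_iff φ hsymm hisoF).1 hφ, finrank_graphLift φ hsymm hnd, map_fst_graphLift φ⟩,
    fun φ _ ψ _ h => graphLift_injective (SetLike.coe_injective h), ?_⟩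
  rintro _ ⟨L, rfl, -, hiso, hrank, hmap⟩
  obtain ⟨φ, rfl⟩ :=
    exists_graphLift_eq hmap (comap_inr_eq_perp hsymm hnd hiso hrank hmap)
  exact ⟨φ, (mem_skew_iff φ hsymm hisoF).2 hiso, rfl⟩
end

section
/- If F ⊆ V is a one-dimensional isotropic subspace, then F ⊕ εF^⊥ is the unique Lagrangian K[ε]-submodule L ⊆ V ⊕ εV with π(L) = F. -/
theorem perp_eq_orthogonal {K V : Type*} [Field K] [AddCommGroup V] [Module K V]
    {b₁ : V →ₗ[K] V →ₗ[K] K} (hsymm : ∀ v w : V, b₁ v w = b₁ w v) (F : Submodule K V) :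
    perp b₁ F = LinearMap.BilinForm.orthogonal b₁ F := by
  ext v
  exact forall₂_congr fun f _ => by rw [hsymm v f]

theorem finrank_prod_perp {K V : Type*} [Field K] [AddCommGroup V] [Module K V]
    [FiniteDimensional K V] {b₁ : V →ₗ[K] V →ₗ[K] K} (hsymm : ∀ v w : V, b₁ v w = b₁ w v)
    (hnd : ∀ v : V, (∀ w : V, b₁ v w = 0) → v = 0) (F : Submodule K V) :
    Module.finrank K (F.prod (perp b₁ F)) = Module.finrank K V := by
  have hb : LinearMap.BilinForm.Nondegenerate b₁ :=
    ⟨hnd, fun v h => hnd v fun w => by rw [hsymm, h]⟩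
  let φ : F.prod (perp b₁ F) ≃ₗ[K] F × perp b₁ F :=
    { toFun := fun x => (⟨x.1.1, x.2.1⟩, ⟨x.1.2, x.2.2⟩)
      map_add' := fun _ _ => rfl
      map_smul' := fun _ _ => rfl
      invFun := fun y => ⟨(y.1, y.2), y.1.2, y.2.2⟩
      left_inv := fun _ => rfl
      right_inv := fun _ => rfl }
  rw [φ.finrank_eq, Module.finrank_prod,
    perp_eq_orthogonal hsymm, LinearMap.BilinForm.finrank_orthogonal hb]
  have := F.finrank_le
  omega

theorem le_prod_perp {K V : Type*} [Field K] [AddCommGroup V] [Module K V]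
    (hchar : (2 : K) ≠ 0) {b₁ : V →ₗ[K] V →ₗ[K] K} (hsymm : ∀ v w : V, b₁ v w = b₁ w v)
    {F : Submodule K V} (hdimF : Module.finrank K F = 1) {L : Submodule K (V × V)}
    (hL : ∀ x ∈ L, ∀ y ∈ L, b2 b₁ x y = 0) (hπ : L.map (LinearMap.fst K V V) = F) :
    L ≤ F.prod (perp b₁ F) := by
  obtain ⟨⟨e, he⟩, -, hspan⟩ := finrank_eq_one_iff'.mp hdimF
  have hF : ∀ f ∈ F, ∃ t : K, t • e = f := fun f hf =>
    (hspan ⟨f, hf⟩).imp fun t ht => congrArg Subtype.val ht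
  obtain ⟨⟨e', g⟩, hgL, rfl⟩ : ∃ x ∈ L, x.1 = e := by rwa [← hπ] at he
  have hself : b₁ e' g + b₁ g e' = 0 := congrArg Prod.snd (hL _ hgL _ hgL)
  have heg : b₁ e' g = 0 := by
    rw [hsymm g e', ← two_mul] at hself
    exact (mul_eq_zero.mp hself).resolve_left hchar
  rintro ⟨a, b⟩ hab
  have ha : a ∈ F := hπ ▸ Submodule.mem_map_of_mem (f := LinearMap.fst K V V) hab
  refine ⟨ha, fun f hf => ?_⟩
  obtain ⟨s, rfl⟩ := hF a ha
  obtain ⟨t, rfl⟩ := hF f hf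
  have h : b₁ (s • e') g + b₁ b e' = 0 := congrArg Prod.snd (hL _ hab _ hgL)
  simp_all

theorem stmt11 {K V : Type*} [Field K] [AddCommGroup V] [Module K V] [FiniteDimensional K V]
    (hchar : (2 : K) ≠ 0)
    (b₁ : V →ₗ[K] V →ₗ[K] K)
    (hsymm : ∀ v w : V, b₁ v w = b₁ w v)
    (hnd : ∀ v : V, (∀ w : V, b₁ v w = 0) → v = 0)
    (F : Submodule K V) (hdimF : Module.finrank K F = 1)
    (hisoF : ∀ f ∈ F, ∀ f' ∈ F, b₁ f f' = 0) :
    -- F ⊕ εF^⊥ is a Lagrangian K[ε]-submodule with π(L) = F …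
    ((∀ x ∈ F.prod (perp b₁ F), eps K V x ∈ F.prod (perp b₁ F))
      ∧ (∀ x ∈ F.prod (perp b₁ F), ∀ y ∈ F.prod (perp b₁ F), b2 b₁ x y = 0)
      ∧ Module.finrank K (F.prod (perp b₁ F)) = Module.finrank K V
      ∧ (F.prod (perp b₁ F)).map (LinearMap.fst K V V) = F)
    -- … and it is the unique one
    ∧ (∀ L : Submodule K (V × V),
        (∀ x ∈ L, eps K V x ∈ L) →
        (∀ x ∈ L, ∀ y ∈ L, b2 b₁ x y = 0) →
        Module.finrank K L = Module.finrank K V →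
        L.map (LinearMap.fst K V V) = F →
        L = F.prod (perp b₁ F)) := by
  have hfin := finrank_prod_perp hsymm hnd F
  refine ⟨⟨?_, ?_, hfin, ?_⟩, fun L _ hL hdim hπ =>
    Submodule.eq_of_le_of_finrank_eq (le_prod_perp hchar hsymm hdimF hL hπ) (hdim.trans hfin.symm)⟩
  · rintro x ⟨hx, -⟩
    exact ⟨F.zero_mem, fun f hf => hisoF _ hx f hf⟩
  · rintro x ⟨hx, hx'⟩ y ⟨hy, hy'⟩
    refine Prod.ext (hisoF _ hx _ hy) ?_
    change b₁ x.1 y.2 + b₁ x.2 y.1 = 0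
    rw [hsymm x.1, hy' _ hx, hx' _ hy, add_zero]
  · exact Submodule.prod_map_fst F (perp b₁ F)
end

section
/- Let F ⊆ V be an isotropic subspace of dimension l. Equip the K-vector space F ⊕ ε(V/F^⊥) with the symmetric bilinear form h given by h(f + εv̄, f' + εv̄') = b₁(v, f') + b₁(v', f), where v, v' ∈ V are lifts of v̄, v̄' ∈ V/F^⊥ (this is well defined). Let q : F ⊕ εV → F ⊕ ε(V/F^⊥) be the identity on F and reduction modulo F^⊥ on the ε-part. Then for every l-dimensional subspace F̃ ⊆ F ⊕ ε(V/F^⊥) that is totally isotropic for h, the preimage q^{-1}(F̃) ⊆ F ⊕ εV ⊆ V ⊕ εV is a Lagrangian K[ε]-submodule of V ⊕ εV. Moreover, if F̃ is the image of f ↦ f + εφ(f) for a skew-symmetric linear map φ : F → V/F^⊥, then q^{-1}(F̃) = { f + εv : f ∈ F, v ∈ V, v + F^⊥ = φ(f) }. -/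
theorem LinearMap.finrank_comap_of_surjective {K V W : Type*} [Field K] [AddCommGroup V]
    [Module K V] [FiniteDimensional K V] [AddCommGroup W] [Module K W]
    (f : V →ₗ[K] W) (hf : Function.Surjective f) (p : Submodule K W) :
    Module.finrank K (p.comap f) = Module.finrank K p + Module.finrank K (LinearMap.ker f) := by
  rw [← LinearMap.finrank_range_add_finrank_ker (f.domRestrict (p.comap f)),
    LinearMap.range_domRestrict, Submodule.map_comap_eq_of_surjective hf, LinearMap.ker_domRestrict,
    (Submodule.comapSubtypeEquivOfLe (LinearMap.ker_le_comap f)).finrank_eq]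

theorem finrank_ker_prodMap_id_mkQ {K V : Type*} [Field K] [AddCommGroup V] [Module K V]
    (P : Submodule K V) :
    Module.finrank K (LinearMap.ker ((LinearMap.id : V →ₗ[K] V).prodMap P.mkQ))
      = Module.finrank K P := by
  have h : LinearMap.ker ((LinearMap.id : V →ₗ[K] V).prodMap P.mkQ)
      = P.map (LinearMap.inr K V V) := by
    rw [LinearMap.ker_prodMap, LinearMap.ker_id, Submodule.ker_mkQ, Submodule.map_inr]
  rw [h, ← (Submodule.equivMapOfInjective _ LinearMap.inr_injective P).finrank_eq]

theorem finrank_perp {K V : Type*} [Field K] [AddCommGroup V] [Module K V]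
    [FiniteDimensional K V] (b₁ : V →ₗ[K] V →ₗ[K] K)
    (hsymm : ∀ v w : V, b₁ v w = b₁ w v)
    (hnd : ∀ v : V, (∀ w : V, b₁ v w = 0) → v = 0) (F : Submodule K V) :
    Module.finrank K (perp b₁ F) = Module.finrank K V - Module.finrank K F := by
  have h : perp b₁ F = LinearMap.BilinForm.orthogonal b₁ F := by
    ext v
    exact forall₂_congr fun f _ => by rw [hsymm]
  rw [h]
  refine LinearMap.BilinForm.finrank_orthogonal ⟨hnd, fun v hv => hnd v fun w => ?_⟩ F
  rw [hsymm, hv]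

theorem stmt13 {K V : Type*} [Field K] [AddCommGroup V] [Module K V] [FiniteDimensional K V]
    (hchar : (2 : K) ≠ 0)
    (b₁ : V →ₗ[K] V →ₗ[K] K)
    (hsymm : ∀ v w : V, b₁ v w = b₁ w v)
    (hnd : ∀ v : V, (∀ w : V, b₁ v w = 0) → v = 0)
    (F : Submodule K V) (l : ℕ) (hdimF : Module.finrank K F = l)
    (hisoF : ∀ f ∈ F, ∀ f' ∈ F, b₁ f f' = 0) :
    -- q⁻¹(F̃) is Lagrangian for every l-dimensional h-isotropic F̃ ⊆ F ⊕ ε(V/F^⊥)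
    (∀ Ft : Submodule K (V × (V ⧸ perp b₁ F)),
      Module.finrank K Ft = l →
      Ft ≤ Submodule.comap (LinearMap.fst K V (V ⧸ perp b₁ F)) F →
      (∀ x ∈ Ft, ∀ y ∈ Ft, ∀ v w : V,
        Submodule.Quotient.mk v = x.2 → Submodule.Quotient.mk w = y.2 →
        b₁ v y.1 + b₁ w x.1 = 0) →
      (∀ x ∈ Submodule.comap (LinearMap.prodMap LinearMap.id (perp b₁ F).mkQ) Ft,
          eps K V x ∈ Submodule.comap (LinearMap.prodMap LinearMap.id (perp b₁ F).mkQ) Ft)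
      ∧ (∀ x ∈ Submodule.comap (LinearMap.prodMap LinearMap.id (perp b₁ F).mkQ) Ft,
          ∀ y ∈ Submodule.comap (LinearMap.prodMap LinearMap.id (perp b₁ F).mkQ) Ft,
          b2 b₁ x y = 0)
      ∧ Module.finrank K (Submodule.comap (LinearMap.prodMap LinearMap.id (perp b₁ F).mkQ) Ft)
          = Module.finrank K V)
    -- if F̃ is the graph of a skew-symmetric φ, then q⁻¹(F̃) = L_φ
    ∧ (∀ φ : ↥F →ₗ[K] V ⧸ perp b₁ F, φ ∈ Skew b₁ F →
        ((Submodule.comap (LinearMap.prodMap LinearMap.id (perp b₁ F).mkQ)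
            (LinearMap.range (F.subtype.prod φ)) : Submodule K (V × V)) : Set (V × V))
          = {x : V × V | ∃ h : x.1 ∈ F, Submodule.Quotient.mk x.2 = φ ⟨x.1, h⟩}) := by
  refine ⟨fun Ft hdim hfst hiso => ⟨fun x hx => ?_, fun x hx y hy => ?_, ?_⟩, fun φ _ => ?_⟩
  · have h0 : (perp b₁ F).mkQ x.1 = 0 :=
      (Submodule.Quotient.mk_eq_zero _).2 (hisoF x.1 (hfst hx))
    have h : LinearMap.prodMap LinearMap.id (perp b₁ F).mkQ (eps K V x) = 0 :=
      Prod.ext rfl h0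
    rw [Submodule.mem_comap, h]
    exact Ft.zero_mem
  · refine Prod.ext (hisoF x.1 (hfst hx) y.1 (hfst hy)) ?_
    change b₁ x.1 y.2 + b₁ x.2 y.1 = 0
    rw [hsymm x.1, add_comm]
    exact hiso _ hx _ hy x.2 y.2 rfl rfl
  · rw [LinearMap.finrank_comap_of_surjective _
      (Function.surjective_id.prodMap (Submodule.mkQ_surjective _)), finrank_ker_prodMap_id_mkQ,
      finrank_perp b₁ hsymm hnd, hdim, ← hdimF, Nat.add_sub_cancel' F.finrank_le]
  · ext x
    constructor
    · rintro ⟨f, hf⟩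
      obtain ⟨h1, h2⟩ := Prod.ext_iff.1 hf
      have hmem : x.1 ∈ F := h1 ▸ f.2
      have hfx : f = ⟨x.1, hmem⟩ := Subtype.ext h1
      exact ⟨hmem, h2.symm.trans (congrArg φ hfx)⟩
    · rintro ⟨h, hx⟩
      exact ⟨⟨x.1, h⟩, Prod.ext rfl hx.symm⟩
end
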